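/- Let G be a d-regular simple graph on n vertices and let λ_n(G) denote the smallest eigenvalue of the adjacency matrix of G. Then for every subset S ⊆ V(G), the number e(S) of edges of G with both endpoints in S satisfies e(S) ≥ |S| · (|S|·d + (n − |S|)·λ_n(G)) / (2n). -/

import Mathlib

open Matrix in
/-- The Rayleigh quotient of a real symmetric matrix is at least its smallest eigenvalue. -/
theorem Matrix.IsHermitian.iInf_eigenvalues_mul_dotProduct_le {n : Type*} [Fintype n]
    [DecidableEq n] {A : Matrix n n ℝ} (hA : A.IsHermitian) (x : n → ℝ) :
    (⨅ i, hA.eigenvalues i) * (x ⬝ᵥ x) ≤ x ⬝ᵥ A *ᵥ x := by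
  have hpsd : (A - algebraMap ℝ (Matrix n n ℝ) (⨅ i, hA.eigenvalues i)).PosSemidef := by
    refine posSemidef_iff_isHermitian_and_spectrum_nonneg.2 ⟨hA.sub ?_, ?_⟩
    · simp [IsHermitian, algebraMap_eq_diagonal]
    · intro r hr
      rw [← spectrum.sub_singleton_eq, Set.sub_singleton,
        hA.spectrum_real_eq_range_eigenvalues] at hr
      obtain ⟨_, ⟨i, rfl⟩, rfl⟩ := hr
      exact sub_nonneg.2 (ciInf_le (Set.finite_range hA.eigenvalues).bddBelow i)
  have h := hpsd.dotProduct_mulVec_nonneg x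
  simpa [sub_mulVec, Algebra.algebraMap_eq_smul_one, smul_mulVec, dotProduct_sub] using h

namespace SimpleGraph

open Matrix in
/-- Twice the number of edges inside `S` is the quadratic form of the adjacency matrix at the
indicator of `S`. -/
theorem two_mul_card_edges_within_eq_dotProduct {V : Type*} [Fintype V] [DecidableEq V]
    (G : SimpleGraph V) [DecidableRel G.Adj] (S : Finset V) :
    2 * ((G.edgeFinset.filter fun e => ∀ v ∈ e, v ∈ S).card : ℝ) =
      (fun v => if v ∈ S then 1 else 0) ⬝ᵥ G.adjMatrix ℝ *ᵥ (fun v => if v ∈ S then 1 else 0) := by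
  let H : SimpleGraph V :=
    { Adj := fun a b => G.Adj a b ∧ a ∈ S ∧ b ∈ S
      symm := ⟨fun _ _ h => ⟨h.1.symm, h.2.2, h.2.1⟩⟩
      loopless := ⟨fun _ h => G.irrefl h.1⟩ }
  have : DecidableRel H.Adj := fun a b => inferInstanceAs (Decidable (G.Adj a b ∧ a ∈ S ∧ b ∈ S))
  have hE : (G.edgeFinset.filter fun e => ∀ v ∈ e, v ∈ S) = H.edgeFinset := by
    ext e
    induction e with
    | h a b => simp [H]
  have h := H.natCast_card_dart_eq_dotProduct (α := ℝ)
  rw [H.dart_card_eq_twice_card_edges] at h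
  rw [hE]
  push_cast at h
  rw [h]
  simp only [dotProduct, mulVec, adjMatrix_apply, Finset.mul_sum]
  simp only [H, Pi.one_apply, mul_one]
  refine Finset.sum_congr rfl fun a _ => Finset.sum_congr rfl fun b _ => ?_
  by_cases ha : a ∈ S <;> by_cases hb : b ∈ S <;> simp [ha, hb]

end SimpleGraph

open Matrix in
/-- **Expander Mixing Lemma** (Bussemaker–Cvetković–Seidel, Alon–Chung).
If `G` is an `n`-vertex `d`-regular graph, then for every `S ⊆ V(G)` the number `e(S)` of
edges with both endpoints in `S` satisfies
`e(S) ≥ |S| * (|S| * d + (n - |S|) * λₙ(G)) / (2n)`,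
where `λₙ(G)` is the smallest adjacency eigenvalue of `G`. -/
theorem expander_mixing_lemma
    {V : Type*} [Fintype V] [DecidableEq V] [Nonempty V]
    (G : SimpleGraph V) [DecidableRel G.Adj] (d : ℕ)
    (hreg : G.IsRegularOfDegree d)
    (hA : (G.adjMatrix ℝ).IsHermitian)
    (S : Finset V) :
    ((G.edgeFinset.filter fun e => ∀ v ∈ e, v ∈ S).card : ℝ) ≥
      (S.card : ℝ) *
        ((S.card : ℝ) * d + ((Fintype.card V : ℝ) - S.card) * (⨅ i, hA.eigenvalues i)) /
          (2 * (Fintype.card V : ℝ)) := by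
  have hn : (0 : ℝ) < Fintype.card V := by exact_mod_cast Fintype.card_pos
  set c := ⨅ i, hA.eigenvalues i
  set n : ℝ := (Fintype.card V : ℝ)
  set s : ℝ := (S.card : ℝ)
  set f : V → ℝ := fun v => if v ∈ S then 1 else 0
  have hmul : G.adjMatrix ℝ *ᵥ (1 : V → ℝ) = (d : ℝ) • (1 : V → ℝ) := by
    ext v
    simp [SimpleGraph.adjMatrix_mulVec_apply, hreg.degree_eq v]
  have hvec : (1 : V → ℝ) ᵥ* G.adjMatrix ℝ = (d : ℝ) • (1 : V → ℝ) := by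
    rw [← mulVec_transpose, G.transpose_adjMatrix, hmul]
  have hff : f ⬝ᵥ f = s := by simp [f, s, dotProduct]
  have hf1 : f ⬝ᵥ 1 = s := by simp [f, s, dotProduct]
  have h1f : 1 ⬝ᵥ f = s := by rw [dotProduct_comm, hf1]
  have h11 : (1 : V → ℝ) ⬝ᵥ 1 = n := by simp [n, dotProduct]
  have hray := hA.iInf_eigenvalues_mul_dotProduct_le (f - (s / n) • (1 : V → ℝ))
  simp only [mulVec_sub, mulVec_smul, hmul, sub_dotProduct, dotProduct_sub, smul_dotProduct,
    dotProduct_smul, dotProduct_mulVec 1, hvec, hff, hf1, h1f, h11, smul_eq_mul,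
    ← G.two_mul_card_edges_within_eq_dotProduct S, f] at hray
  rw [ge_iff_le, div_le_iff₀ (by positivity)]
  field_simp at hray
  nlinarith
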